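/- arXiv:2304.14555 — 4 statements merged into one kernel-verified Lean document; each statement's English description precedes it below -/
import Mathlib

section
/- Let χ be a character of ℚ₃^× with finite conductor. Then: a(χ³) = a(χ) if a(χ) = 0 or a(χ) = 1; a(χ³) = 0 if a(χ) = 2 and the restriction of χ to ℤ₃^× has order 3; and a(χ³) = a(χ) − 1 in all remaining cases (i.e., if a(χ) = 2 with the restriction of χ to ℤ₃^× of order different from 3, or if a(χ) ≥ 3). -/
noncomputable section

/-- `IsTrivOn p χ n` says that the character `χ` of `ℚ_p^×` is trivial on the subgroup
`U^n`, where `U^0 = ℤ_p^×` and `U^n = 1 + p^n ℤ_p` for `n ≥ 1`. -/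
def IsTrivOn (p : ℕ) [Fact p.Prime] (χ : (ℚ_[p])ˣ →* ℂˣ) (n : ℕ) : Prop :=
  if n = 0 then ∀ u : (ℚ_[p])ˣ, ‖(u : ℚ_[p])‖ = 1 → χ u = 1
  else ∀ u : (ℚ_[p])ˣ, (∃ z : ℤ_[p], (u : ℚ_[p]) = 1 + (p : ℚ_[p]) ^ n * (z : ℚ_[p])) → χ u = 1

/-- The conductor `a(χ)` of a character of `ℚ_p^×`: the smallest `n` such that `χ` is
trivial on `U^n`. -/
def condQ (p : ℕ) [Fact p.Prime] (χ : (ℚ_[p])ˣ →* ℂˣ) : ℕ :=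
  sInf {n | IsTrivOn p χ n}

/-- The restriction of a character of `ℚ_p^×` to `ℤ_p^×`. -/
def restrQ (p : ℕ) [Fact p.Prime] (χ : (ℚ_[p])ˣ →* ℂˣ) : (ℤ_[p])ˣ →* ℂˣ :=
  χ.comp (Units.map (PadicInt.Coe.ringHom.toMonoidHom))

theorem isTrivOn_iff_restrQ (p : ℕ) [Fact p.Prime] (χ : (ℚ_[p])ˣ →* ℂˣ) (n : ℕ) :
    IsTrivOn p χ n ↔ ∀ v : (ℤ_[p])ˣ, (p : ℤ_[p]) ^ n ∣ (v : ℤ_[p]) - 1 → restrQ p χ v = 1 := by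
  have lift : ∀ u : (ℚ_[p])ˣ, ‖(u : ℚ_[p])‖ = 1 →
      ∃ v : (ℤ_[p])ˣ, Units.map PadicInt.Coe.ringHom.toMonoidHom v = u :=
    fun u hu => ⟨PadicInt.mkUnits hu, Units.ext rfl⟩
  rcases Nat.eq_zero_or_pos n with rfl | hn
  · simp only [IsTrivOn, if_true, pow_zero, isUnit_one.dvd, true_imp_iff]
    refine ⟨fun h v => h _ (PadicInt.norm_units v), fun h u hu => ?_⟩
    obtain ⟨v, rfl⟩ := lift u hu
    exact h v
  · simp only [IsTrivOn, hn.ne', if_false]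
    constructor
    · rintro h v ⟨z, hz⟩
      refine h _ ⟨z, ?_⟩
      have hv : (v : ℤ_[p]) = 1 + (p : ℤ_[p]) ^ n * z := by rw [← hz]; ring
      change ((v : ℤ_[p]) : ℚ_[p]) = _
      rw [hv]
      push_cast
      rfl
    · rintro h u ⟨z, hz⟩
      have hu : ‖(u : ℚ_[p])‖ = 1 := by
        have hlt : ‖(p : ℤ_[p]) ^ n * z‖ < 1 := by
          rw [PadicInt.norm_lt_one_iff_dvd]
          exact (dvd_pow_self _ hn.ne').mul_right _
        have hone : ‖(1 : ℤ_[p]) + (p : ℤ_[p]) ^ n * z‖ = 1 := by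
          rw [PadicInt.norm_add_eq_max_of_ne (by rw [norm_one]; exact hlt.ne'), norm_one,
            max_eq_left hlt.le]
        rw [hz]
        rw [PadicInt.norm_def] at hone
        push_cast at hone
        exact hone
      obtain ⟨v, rfl⟩ := lift u hu
      refine h v ⟨z, ?_⟩
      have hv : ((v : ℤ_[p]) : ℚ_[p]) = 1 + (p : ℚ_[p]) ^ n * (z : ℚ_[p]) := hz
      apply Subtype.coe_injective
      push_cast
      rw [hv]
      ring

theorem IsTrivOn.mono {p : ℕ} [Fact p.Prime] {χ : (ℚ_[p])ˣ →* ℂˣ} {m n : ℕ}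
    (h : IsTrivOn p χ m) (hmn : m ≤ n) : IsTrivOn p χ n := by
  rw [isTrivOn_iff_restrQ] at h ⊢
  exact fun v hv => h v ((pow_dvd_pow _ hmn).trans hv)

theorem isTrivOn_zero_iff_restrQ_eq_one {p : ℕ} [Fact p.Prime] {χ : (ℚ_[p])ˣ →* ℂˣ} :
    IsTrivOn p χ 0 ↔ restrQ p χ = 1 := by
  simp [isTrivOn_iff_restrQ, MonoidHom.ext_iff]

theorem restrQ_pow (p : ℕ) [Fact p.Prime] (χ : (ℚ_[p])ˣ →* ℂˣ) (k : ℕ) :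
    restrQ p (χ ^ k) = restrQ p χ ^ k := rfl

theorem condQ_eq_zero_of_isTrivOn {p : ℕ} [Fact p.Prime] {χ : (ℚ_[p])ˣ →* ℂˣ}
    (h : IsTrivOn p χ 0) : condQ p χ = 0 :=
  Nat.sInf_eq_zero.2 (Or.inl h)

theorem condQ_eq_succ_iff {p : ℕ} [Fact p.Prime] {χ : (ℚ_[p])ˣ →* ℂˣ} {n : ℕ} :
    condQ p χ = n + 1 ↔ IsTrivOn p χ (n + 1) ∧ ¬ IsTrivOn p χ n :=
  Nat.sInf_upward_closed_eq_succ_iff (fun _ _ hle h => IsTrivOn.mono h hle) n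

theorem isTrivOn_condQ {p : ℕ} [Fact p.Prime] {χ : (ℚ_[p])ˣ →* ℂˣ}
    (h : ∃ n, IsTrivOn p χ n) : IsTrivOn p χ (condQ p χ) :=
  Nat.sInf_mem h

theorem one_add_three_pow_mul_cube {R : Type*} [CommRing R] (n : ℕ) (z : R) :
    (1 + 3 ^ (n + 1) * z) ^ 3 =
      1 + 3 ^ (n + 2) * z + 3 ^ (n + 3) * (3 ^ n * z ^ 2 + 3 ^ (2 * n) * z ^ 3) := by
  ring

theorem IsTrivOn.cube {χ : (ℚ_[3])ˣ →* ℂˣ} {n : ℕ} (h : IsTrivOn 3 χ (n + 2)) :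
    IsTrivOn 3 (χ ^ 3) (n + 1) := by
  rw [isTrivOn_iff_restrQ] at h ⊢
  rintro v ⟨z, hz⟩
  rw [restrQ_pow, MonoidHom.pow_apply, ← map_pow]
  refine h _ ⟨z + 3 * (3 ^ n * z ^ 2 + 3 ^ (2 * n) * z ^ 3), ?_⟩
  rw [Units.val_pow_eq_pow_val, eq_add_of_sub_eq' hz]
  push_cast
  rw [one_add_three_pow_mul_cube]
  ring

theorem IsTrivOn.of_cube {χ : (ℚ_[3])ˣ →* ℂˣ} {n : ℕ} (h : IsTrivOn 3 χ (n + 3))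
    (hcube : IsTrivOn 3 (χ ^ 3) (n + 1)) : IsTrivOn 3 χ (n + 2) := by
  rw [isTrivOn_iff_restrQ] at h hcube ⊢
  rintro v ⟨z, hz⟩
  have hw : IsUnit (1 + 3 ^ (n + 1) * z : ℤ_[3]) := by
    rw [add_comm]
    refine (IsLocalRing.notMem_maximalIdeal).1 fun hmem => ?_
    have hp : (3 ^ (n + 1) * z : ℤ_[3]) ∈ IsLocalRing.maximalIdeal ℤ_[3] := by
      rw [PadicInt.maximalIdeal_eq_span_p, Ideal.mem_span_singleton]
      exact (dvd_pow_self _ n.succ_ne_zero).mul_right _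
    exact (IsLocalRing.notMem_maximalIdeal).2 isUnit_one ((Ideal.add_mem_iff_right _ hp).1 hmem)
  obtain ⟨w, hw⟩ := hw
  have hw3 : restrQ 3 χ (w ^ 3) = 1 := by
    rw [map_pow]
    exact hcube w ⟨z, by rw [hw]; push_cast; ring⟩
  have hquot : restrQ 3 χ (v * (w ^ 3)⁻¹) = 1 := by
    refine h _ ⟨-(3 ^ n * z ^ 2 + 3 ^ (2 * n) * z ^ 3) * ((w ^ 3)⁻¹ : (ℤ_[3])ˣ), ?_⟩
    have hinv : ((w ^ 3 : (ℤ_[3])ˣ) : ℤ_[3]) * ((w ^ 3)⁻¹ : (ℤ_[3])ˣ) = 1 := Units.mul_inv _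
    have hcb := one_add_three_pow_mul_cube n z
    rw [← hw, ← Units.val_pow_eq_pow_val] at hcb
    rw [Units.val_mul, eq_add_of_sub_eq' hz]
    push_cast at hinv hcb ⊢
    linear_combination hinv - ((w⁻¹ : (ℤ_[3])ˣ) : ℤ_[3]) ^ 3 * hcb
  rwa [map_mul, map_inv, hw3, inv_one, mul_one] at hquot

theorem PadicInt.three_dvd_units_sq_sub_one (v : (ℤ_[3])ˣ) : (3 : ℤ_[3]) ∣ (v : ℤ_[3]) ^ 2 - 1 := by
  have hker : (v : ℤ_[3]) ^ 2 - 1 ∈ RingHom.ker (PadicInt.toZMod (p := 3)) := by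
    have hsq : ∀ x : (ZMod 3)ˣ, (x : ZMod 3) ^ 2 - 1 = 0 := by decide
    rw [RingHom.mem_ker, map_sub, map_pow, map_one]
    exact hsq (Units.map (PadicInt.toZMod (p := 3)).toMonoidHom v)
  rw [PadicInt.ker_toZMod, PadicInt.maximalIdeal_eq_span_p, Ideal.mem_span_singleton] at hker
  exact_mod_cast hker

theorem restrQ_cube_of_isTrivOn_one {χ : (ℚ_[3])ˣ →* ℂˣ} (h : IsTrivOn 3 χ 1) :
    restrQ 3 (χ ^ 3) = restrQ 3 χ := by
  rw [isTrivOn_iff_restrQ] at h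
  ext1 v
  have hv : restrQ 3 χ v ^ 2 = 1 := by
    rw [← map_pow]
    refine h _ ?_
    rw [pow_one, Units.val_pow_eq_pow_val]
    exact PadicInt.three_dvd_units_sq_sub_one v
  rw [restrQ_pow, MonoidHom.pow_apply, pow_succ, hv, one_mul]

theorem condQ_congr {p : ℕ} [Fact p.Prime] {χ χ' : (ℚ_[p])ˣ →* ℂˣ}
    (h : restrQ p χ = restrQ p χ') : condQ p χ = condQ p χ' := by
  simp only [condQ, isTrivOn_iff_restrQ, h]

/-- Conductor of the cube of a character of `ℚ₃^×`:
`a(χ³) = a(χ)` if `a(χ) ∈ {0,1}`; `a(χ³) = 0` if `a(χ) = 2` and the restriction of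
`χ` to `ℤ₃^×` has order `3`; and `a(χ³) = a(χ) - 1` otherwise. -/
theorem conductor_cube_three (χ : (ℚ_[3])ˣ →* ℂˣ) (hfin : ∃ n, IsTrivOn 3 χ n) :
    ((condQ 3 χ = 0 ∨ condQ 3 χ = 1) → condQ 3 (χ ^ 3) = condQ 3 χ) ∧
    ((condQ 3 χ = 2 ∧ orderOf (restrQ 3 χ) = 3) → condQ 3 (χ ^ 3) = 0) ∧
    ((condQ 3 χ = 2 ∧ orderOf (restrQ 3 χ) ≠ 3) → condQ 3 (χ ^ 3) = condQ 3 χ - 1) ∧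
    (3 ≤ condQ 3 χ → condQ 3 (χ ^ 3) = condQ 3 χ - 1) := by
  refine ⟨fun h => ?_, fun ⟨_, hord⟩ => ?_, fun ⟨h, hord⟩ => ?_, fun h => ?_⟩
  · exact condQ_congr (restrQ_cube_of_isTrivOn_one ((isTrivOn_condQ hfin).mono (by omega)))
  · refine condQ_eq_zero_of_isTrivOn (isTrivOn_zero_iff_restrQ_eq_one.2 ?_)
    exact orderOf_dvd_iff_pow_eq_one.1 hord.dvd
  · obtain ⟨htriv, hnot⟩ := condQ_eq_succ_iff.1 h
    rw [h]
    refine condQ_eq_succ_iff.2 ⟨htriv.cube, fun hcube => hord ?_⟩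
    refine orderOf_eq_prime (isTrivOn_zero_iff_restrQ_eq_one.1 hcube) fun hone => hnot ?_
    exact (isTrivOn_zero_iff_restrQ_eq_one.2 hone).mono zero_le_one
  · obtain ⟨n, hn⟩ := Nat.exists_eq_add_of_le' h
    obtain ⟨htriv, hnot⟩ := condQ_eq_succ_iff.1 hn
    rw [hn]
    exact condQ_eq_succ_iff.2 ⟨htriv.cube, fun hcube => hnot (htriv.of_cube hcube)⟩
end
end

section
/- Let χ be a character of ℚ₂^× with finite conductor. Then a(χ) ≠ 1; moreover a(χ²) = 0 if a(χ) ∈ {0, 2, 3}, and a(χ²) = a(χ) − 1 if a(χ) ≥ 4. -/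
noncomputable section

theorem isTrivOn_zero_iff {p : ℕ} [Fact p.Prime] {χ : (ℚ_[p])ˣ →* ℂˣ} :
    IsTrivOn p χ 0 ↔ ∀ u : (ℚ_[p])ˣ, ‖(u : ℚ_[p])‖ = 1 → χ u = 1 := by
  simp [IsTrivOn]

theorem isTrivOn_iff_of_ne_zero {p : ℕ} [Fact p.Prime] {χ : (ℚ_[p])ˣ →* ℂˣ} {n : ℕ}
    (hn : n ≠ 0) :
    IsTrivOn p χ n ↔ ∀ (u : (ℚ_[p])ˣ) (z : ℤ_[p]),
      (u : ℚ_[p]) = 1 + (p : ℚ_[p]) ^ n * (z : ℚ_[p]) → χ u = 1 := by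
  simp [IsTrivOn, hn]

@[simp, norm_cast]
theorem PadicInt.coe_ofNat {p : ℕ} [Fact p.Prime] (n : ℕ) [n.AtLeastTwo] :
    ((ofNat(n) : ℤ_[p]) : ℚ_[p]) = ofNat(n) :=
  PadicInt.coe_natCast n

/-- Every 2-adic integer is even or odd. -/
theorem PadicInt.even_or_odd_two (x : ℤ_[2]) : ∃ y : ℤ_[2], x = 2 * y ∨ x = 1 + 2 * y := by
  obtain ⟨n, hn, hx⟩ := PadicInt.exists_mem_range (p := 2) x
  rw [PadicInt.maximalIdeal_eq_span_p, Ideal.mem_span_singleton] at hx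
  obtain ⟨y, hy⟩ := hx
  refine ⟨y, ?_⟩
  push_cast at hy
  interval_cases n
  · left; simpa using hy
  · right; push_cast at hy; linear_combination hy

/-- A 2-adic number of norm one is of the form `1 + 2 * y` with `y` integral. -/
theorem Padic.exists_eq_one_add_two_mul {u : ℚ_[2]} (hu : ‖u‖ = 1) :
    ∃ y : ℤ_[2], u = 1 + 2 * (y : ℚ_[2]) := by
  obtain ⟨y, hy | hy⟩ := PadicInt.even_or_odd_two ⟨u, hu.le⟩
  · have h : u = 2 * (y : ℚ_[2]) := by simpa using congrArg ((↑) : ℤ_[2] → ℚ_[2]) hy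
    have h2 : ‖(2 : ℚ_[2])‖ = 2⁻¹ := by simpa using Padic.norm_p (p := 2)
    have h1 := PadicInt.norm_le_one y
    rw [h, norm_mul, h2, PadicInt.padic_norm_e_of_padicInt] at hu
    linarith
  · exact ⟨y, by simpa using congrArg ((↑) : ℤ_[2] → ℚ_[2]) hy⟩

theorem Padic.norm_one_add_prime_pow_mul {p : ℕ} [Fact p.Prime] {n : ℕ} (hn : n ≠ 0)
    (z : ℤ_[p]) : ‖1 + (p : ℚ_[p]) ^ n * (z : ℚ_[p])‖ = 1 := by
  have h : ‖(p : ℚ_[p]) ^ n * (z : ℚ_[p])‖ < 1 := by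
    rw [norm_mul, norm_pow]
    exact mul_lt_one_of_nonneg_of_lt_one_left (by positivity)
      (pow_lt_one₀ (norm_nonneg _) Padic.norm_p_lt_one hn) (PadicInt.norm_le_one z)
  rw [IsUltrametricDist.norm_add_eq_max_of_norm_ne_norm (by rw [norm_one]; exact h.ne'),
    norm_one, max_eq_left h.le]

/-- For `p = 2` the groups `U^0` and `U^1` coincide. -/
theorem IsTrivOn.zero_of_one {χ : (ℚ_[2])ˣ →* ℂˣ} (h : IsTrivOn 2 χ 1) : IsTrivOn 2 χ 0 := by
  rw [isTrivOn_zero_iff]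
  intro u hu
  obtain ⟨y, hy⟩ := Padic.exists_eq_one_add_two_mul hu
  exact (isTrivOn_iff_of_ne_zero one_ne_zero).mp h u y (by simpa using hy)

/-- Squares of 2-adic units lie in `U^3`. -/
theorem IsTrivOn.sq_zero {χ : (ℚ_[2])ˣ →* ℂˣ} (h : IsTrivOn 2 χ 3) : IsTrivOn 2 (χ ^ 2) 0 := by
  rw [isTrivOn_zero_iff]
  intro u hu
  obtain ⟨y, hy⟩ := Padic.exists_eq_one_add_two_mul hu
  rw [MonoidHom.pow_apply, ← map_pow]
  obtain ⟨t, rfl | rfl⟩ := PadicInt.even_or_odd_two y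
  · refine (isTrivOn_iff_of_ne_zero three_ne_zero).mp h _ (t + 2 * t ^ 2) ?_
    rw [Units.val_pow_eq_pow_val, hy]
    push_cast
    ring
  · refine (isTrivOn_iff_of_ne_zero three_ne_zero).mp h _ (1 + 3 * t + 2 * t ^ 2) ?_
    rw [Units.val_pow_eq_pow_val, hy]
    push_cast
    ring

/-- Squaring maps `U^n` into `U^(n+1)` for `n ≥ 1`. -/
theorem IsTrivOn.sq {χ : (ℚ_[2])ˣ →* ℂˣ} {n : ℕ} (hn : n ≠ 0) (h : IsTrivOn 2 χ (n + 1)) :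
    IsTrivOn 2 (χ ^ 2) n := by
  rw [isTrivOn_iff_of_ne_zero hn]
  intro u z hu
  obtain ⟨k, rfl⟩ := Nat.exists_eq_succ_of_ne_zero hn
  rw [MonoidHom.pow_apply, ← map_pow]
  refine (isTrivOn_iff_of_ne_zero (Nat.succ_ne_zero _)).mp h _ (z + 2 ^ k * z ^ 2) ?_
  simp only [Units.val_pow_eq_pow_val, hu, Nat.succ_eq_add_one]
  push_cast
  ring

/-- By Hensel's lemma, every element of `U^(n+1)` is the square of an element of `U^n`
when `n ≥ 2`. -/
theorem PadicInt.exists_one_add_two_pow_mul_sq {n : ℕ} (hn : 2 ≤ n) (z : ℤ_[2]) :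
    ∃ w : ℤ_[2], (1 + 2 ^ n * w) ^ 2 = 1 + 2 ^ (n + 1) * z := by
  obtain ⟨k, rfl⟩ := Nat.exists_eq_add_of_le hn
  have h2 : ‖(2 : ℤ_[2])‖ < 1 := by
    rw [PadicInt.norm_def, PadicInt.coe_ofNat]
    exact_mod_cast Padic.norm_p_lt_one (p := 2)
  have hlt (x : ℤ_[2]) : ‖2 * x‖ < 1 := by
    rw [norm_mul]
    exact mul_lt_one_of_nonneg_of_lt_one_left (norm_nonneg _) h2 (PadicInt.norm_le_one x)
  let F : Polynomial ℤ_[2] :=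
    Polynomial.C (2 ^ (k + 1)) * Polynomial.X ^ 2 + Polynomial.X - Polynomial.C z
  have hF (x : ℤ_[2]) : Polynomial.aeval x F = 2 ^ (k + 1) * x ^ 2 + x - z := by simp [F]
  have hF' : Polynomial.aeval z F.derivative = 1 + 2 * (2 ^ (k + 1) * z) := by
    simp [F, -map_pow]
    ring
  have hnorm : ‖Polynomial.aeval z F.derivative‖ = 1 := by
    rw [hF', IsUltrametricDist.norm_add_eq_max_of_norm_ne_norm
      (by rw [norm_one]; exact (hlt _).ne'), norm_one, max_eq_left (hlt _).le]
  obtain ⟨w, hw, -⟩ := hensels_lemma (F := F) (a := z) (by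
    rw [hnorm, hF, one_pow]
    convert hlt (2 ^ k * z ^ 2) using 2
    ring)
  rw [hF] at hw
  refine ⟨w, ?_⟩
  linear_combination 2 ^ (2 + k + 1) * hw

theorem IsTrivOn.of_sq {χ : (ℚ_[2])ˣ →* ℂˣ} {n : ℕ} (hn : 2 ≤ n) (h : IsTrivOn 2 (χ ^ 2) n) :
    IsTrivOn 2 χ (n + 1) := by
  rw [isTrivOn_iff_of_ne_zero n.succ_ne_zero]
  intro u z hu
  obtain ⟨w, hw⟩ := PadicInt.exists_one_add_two_pow_mul_sq hn z
  have hw' : (1 + 2 ^ n * (w : ℚ_[2])) ^ 2 = u := by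
    rw [hu]
    exact_mod_cast congrArg ((↑) : ℤ_[2] → ℚ_[2]) hw
  have hne : 1 + 2 ^ n * (w : ℚ_[2]) ≠ 0 := fun h0 ↦ u.ne_zero (by rw [← hw', h0]; simp)
  have huv : u = Units.mk0 _ hne ^ 2 := Units.ext (by simp [hw'])
  rw [huv, map_pow, ← MonoidHom.pow_apply]
  exact (isTrivOn_iff_of_ne_zero (by lia)).mp h _ w (by simp)

theorem condQ_le {p : ℕ} [Fact p.Prime] {χ : (ℚ_[p])ˣ →* ℂˣ} {n : ℕ} (h : IsTrivOn p χ n) :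
    condQ p χ ≤ n :=
  Nat.sInf_le h

/-- For a character `χ` of `ℚ₂^×` with finite conductor: `a(χ) ≠ 1`; moreover
`a(χ²) = 0` if `a(χ) ∈ {0, 2, 3}`, and `a(χ²) = a(χ) - 1` if `a(χ) ≥ 4`. -/
theorem conductor_square_two (χ : (ℚ_[2])ˣ →* ℂˣ) (hfin : ∃ n, IsTrivOn 2 χ n) :
    condQ 2 χ ≠ 1 ∧
    ((condQ 2 χ = 0 ∨ condQ 2 χ = 2 ∨ condQ 2 χ = 3) → condQ 2 (χ ^ 2) = 0) ∧
    (4 ≤ condQ 2 χ → condQ 2 (χ ^ 2) = condQ 2 χ - 1) := by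
  have hc := isTrivOn_condQ hfin
  refine ⟨fun h1 ↦ ?_, fun hle ↦ ?_, fun hge ↦ ?_⟩
  · rw [h1] at hc
    have := condQ_le hc.zero_of_one
    lia
  · exact Nat.le_zero.mp (condQ_le (hc.mono (n := 3) (by lia)).sq_zero)
  · have hsq : IsTrivOn 2 (χ ^ 2) (condQ 2 χ - 1) :=
      IsTrivOn.sq (by lia) (by rwa [Nat.sub_add_cancel (by lia)])
    refine le_antisymm (condQ_le hsq) ?_
    by_contra! hlt
    have h := (isTrivOn_condQ ⟨_, hsq⟩).mono (n := condQ 2 χ - 2) (by lia)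
    have := condQ_le (h.of_sq (by lia))
    lia
end
end

section
/- Let K be a ramified quadratic extension of ℚ₃ and χ a character of K^× with conductor a(χ) ≥ 2. Then a(χ³) ≤ a(χ) − 1; in particular a(χ³) ≠ a(χ). -/
set_option synthInstance.maxHeartbeats 1000000

noncomputable section

instance algebraPadicInt (p : ℕ) [Fact p.Prime] (K : Type*) [Field K] [Algebra ℚ_[p] K] :
    Algebra ℤ_[p] K :=
  ((algebraMap ℚ_[p] K).comp PadicInt.Coe.ringHom).toAlgebra

/-- The ring of integers `O_K` of a finite extension `K` of `ℚ_p`: the integral closure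
of `ℤ_p` in `K`. -/
def ringOfInt (p : ℕ) [Fact p.Prime] (K : Type*) [Field K] [Algebra ℚ_[p] K] :
    Subalgebra ℤ_[p] K :=
  integralClosure ℤ_[p] K

/-- The maximal ideal `m_K` of the local ring `O_K` (its Jacobson radical). -/
def maxIdeal (p : ℕ) [Fact p.Prime] (K : Type*) [Field K] [Algebra ℚ_[p] K] :
    Ideal (ringOfInt p K) :=
  (⊥ : Ideal (ringOfInt p K)).jacobson

/-- `O_K^×` as a subgroup of `K^×`. -/
def unitsO (p : ℕ) [Fact p.Prime] (K : Type*) [Field K] [Algebra ℚ_[p] K] : Subgroup Kˣ where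
  carrier := {u | (u : K) ∈ ringOfInt p K ∧ ((u⁻¹ : Kˣ) : K) ∈ ringOfInt p K}
  one_mem' := ⟨by simpa using (ringOfInt p K).one_mem, by simpa using (ringOfInt p K).one_mem⟩
  mul_mem' := by
    rintro a b ⟨ha1, ha2⟩ ⟨hb1, hb2⟩
    refine ⟨?_, ?_⟩
    · rw [Units.val_mul]; exact mul_mem ha1 hb1
    · rw [mul_inv, Units.val_mul]; exact mul_mem ha2 hb2
  inv_mem' := by
    rintro a ⟨ha1, ha2⟩
    exact ⟨ha2, by rw [inv_inv]; exact ha1⟩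

/-- `IsTrivOnK p K χ n` says that the character `χ` of `K^×` is trivial on the subgroup
`U_K^n`, where `U_K^0 = O_K^×` and `U_K^n = 1 + m_K^n` for `n ≥ 1`. -/
def IsTrivOnK (p : ℕ) [Fact p.Prime] (K : Type*) [Field K] [Algebra ℚ_[p] K]
    (χ : Kˣ →* ℂˣ) (n : ℕ) : Prop :=
  if n = 0 then ∀ u : Kˣ, u ∈ unitsO p K → χ u = 1
  else ∀ u : Kˣ, (∃ y : ringOfInt p K, y ∈ (maxIdeal p K) ^ n ∧ (u : K) = 1 + (y : K)) → χ u = 1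

/-- The conductor `a(χ)` of a character of `K^×`: the smallest `n` such that `χ` is
trivial on `U_K^n`. -/
def condK (p : ℕ) [Fact p.Prime] (K : Type*) [Field K] [Algebra ℚ_[p] K]
    (χ : Kˣ →* ℂˣ) : ℕ :=
  sInf {n | IsTrivOnK p K χ n}

/-- The restriction of a character of `K^×` to `O_K^×`. -/
def restrK (p : ℕ) [Fact p.Prime] (K : Type*) [Field K] [Algebra ℚ_[p] K]
    (χ : Kˣ →* ℂˣ) : (unitsO p K) →* ℂˣ :=
  χ.comp (unitsO p K).subtype

/-- If `3 ∈ I ^ 2` and `y ∈ I ^ (k + 1)`, then `(1 + y) ^ 3 - 1 ∈ I ^ (k + 2)`. -/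
theorem cube_sub_one_mem_pow {R : Type*} [CommRing R] {I : Ideal R}
    (h3 : Ideal.span {(3 : R)} ≤ I ^ 2) {k : ℕ} {y : R} (hy : y ∈ I ^ (k + 1)) :
    3 * (y + y ^ 2) + y ^ 3 ∈ I ^ (k + 2) := by
  refine add_mem ?_ ?_
  · have h := Ideal.mul_mem_mul (h3 (Ideal.mem_span_singleton_self 3))
      (add_mem hy (Ideal.pow_mem_of_mem _ hy 2 two_pos))
    rw [← pow_add] at h
    exact Ideal.pow_le_pow_right (by omega) h
  · have h := Ideal.pow_mem_pow hy 3
    rw [← pow_mul] at h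
    exact Ideal.pow_le_pow_right (by omega) h

/-- Let `K` be a ramified quadratic extension of `ℚ₃` (i.e. `3·O_K = m_K²`) and `χ` a
character of `K^×` with conductor `a(χ) ≥ 2`.  Then `a(χ³) ≤ a(χ) - 1`; in particular
`a(χ³) ≠ a(χ)`. -/
theorem conductor_cube_ramified_quadratic (K : Type*) [Field K] [Algebra ℚ_[3] K]
    [FiniteDimensional ℚ_[3] K] (hquad : Module.finrank ℚ_[3] K = 2)
    (hram : Ideal.span {(3 : ringOfInt 3 K)} = (maxIdeal 3 K) ^ 2)
    (χ : Kˣ →* ℂˣ) (hfin : ∃ n, IsTrivOnK 3 K χ n) (h2 : 2 ≤ condK 3 K χ) :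
    condK 3 K (χ ^ 3) ≤ condK 3 K χ - 1 ∧ condK 3 K (χ ^ 3) ≠ condK 3 K χ := by
  have htriv : IsTrivOnK 3 K χ (condK 3 K χ) := Nat.sInf_mem hfin
  obtain ⟨k, hk⟩ : ∃ k, condK 3 K χ = k + 2 := ⟨condK 3 K χ - 2, by omega⟩
  rw [hk] at htriv ⊢
  have hle : condK 3 K (χ ^ 3) ≤ k + 1 := by
    refine Nat.sInf_le ?_
    simp only [Set.mem_ofPred_eq, IsTrivOnK, Nat.add_eq_zero_iff, one_ne_zero, and_false,
      if_false]
    rintro u ⟨y, hy, hu⟩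
    simp only [IsTrivOnK, Nat.add_eq_zero_iff, OfNat.ofNat_ne_zero, and_false, if_false] at htriv
    rw [MonoidHom.pow_apply, ← map_pow]
    refine htriv _ ⟨3 * (y + y ^ 2) + y ^ 3, ?_, ?_⟩
    · exact cube_sub_one_mem_pow hram.le hy
    · have h3 : ((3 : ringOfInt 3 K) : K) = 3 := rfl
      rw [Units.val_pow_eq_pow_val, hu]
      push_cast [h3]
      ring
  omega
end
end

section
/- Let p be a prime, K a finite field extension of ℚ_p, m a positive integer not divisible by p, and χ a character of K^× with conductor a(χ) ≥ 2. Then a(χ^m) = a(χ). -/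
set_option synthInstance.maxHeartbeats 1000000

noncomputable section

theorem one_add_pow_prime_pow_sub_one_mem {R : Type*} [CommRing R] {I : Ideal R} {q : ℕ}
    (hq : q.Prime) (hqI : (q : R) ∈ I) {n : ℕ} (hn : 1 ≤ n) {y : R} (hy : y ∈ I ^ n) (k : ℕ) :
    (1 + y) ^ q ^ k - 1 ∈ I ^ (n + k) := by
  induction k with
  | zero => simpa using hy
  | succ k ih =>
    obtain ⟨r, hr⟩ := exists_add_pow_prime_eq hq 1 ((1 + y) ^ q ^ k - 1)
    rw [add_sub_cancel, ← pow_mul, ← pow_succ] at hr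
    generalize (1 + y) ^ q ^ k - 1 = z at ih hr
    have hz : z ^ q ∈ I ^ (n + (k + 1)) := by
      have h := Ideal.pow_mem_pow ih q
      rw [← pow_mul] at h
      refine Ideal.pow_le_pow_right ?_ h
      nlinarith [hq.two_le]
    have hqz : (q : R) * z ∈ I ^ (n + (k + 1)) := by
      rw [← add_assoc, pow_succ']
      exact Ideal.mul_mem_mul hqI ih
    have : (1 + y) ^ q ^ (k + 1) - 1 = z ^ q + r * (q * z) := by rw [hr]; ring
    rw [this]
    exact add_mem hz (Ideal.mul_mem_left _ _ hqz)

section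

variable (p : ℕ) [Fact p.Prime] (K : Type*) [Field K] [Algebra ℚ_[p] K]

theorem natCast_prime_mem_maxIdeal : (p : ringOfInt p K) ∈ maxIdeal p K := by
  refine Ideal.mem_sInf.2 fun M hM => ?_
  have : M.IsMaximal := hM.2
  have : Algebra.IsIntegral ℤ_[p] (ringOfInt p K) :=
    inferInstanceAs (Algebra.IsIntegral ℤ_[p] (integralClosure ℤ_[p] K))
  have hmax := Ideal.isMaximal_comap_of_isIntegral_of_isMaximal (R := ℤ_[p]) M
  have hp : (p : ℤ_[p]) ∈ M.comap (algebraMap ℤ_[p] (ringOfInt p K)) := by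
    rw [IsLocalRing.eq_maximalIdeal hmax, PadicInt.maximalIdeal_eq_span_p]
    exact Ideal.mem_span_singleton_self _
  simpa using hp

variable {p K}

theorem isTrivOnK_iff_of_pos {χ : Kˣ →* ℂˣ} {n : ℕ} (hn : 1 ≤ n) :
    IsTrivOnK p K χ n ↔
      ∀ u : Kˣ, (∃ y : ringOfInt p K, y ∈ maxIdeal p K ^ n ∧ (u : K) = 1 + (y : K)) →
        χ u = 1 := by
  rw [IsTrivOnK, if_neg (by lia)]

theorem IsTrivOnK.pow {χ : Kˣ →* ℂˣ} {n : ℕ} (h : IsTrivOnK p K χ n) (m : ℕ) :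
    IsTrivOnK p K (χ ^ m) n := by
  unfold IsTrivOnK at h ⊢
  split_ifs at h ⊢ <;> intro u hu <;> simp [h u hu]

theorem IsTrivOnK.one_of_zero {χ : Kˣ →* ℂˣ} (h : IsTrivOnK p K χ 0) : IsTrivOnK p K χ 1 := by
  rw [IsTrivOnK, if_pos rfl] at h
  rw [isTrivOnK_iff_of_pos le_rfl]
  rintro u ⟨y, hy, hu⟩
  rw [pow_one] at hy
  obtain ⟨v, hv⟩ := Ideal.mem_jacobson_bot.1 hy 1
  have hvu : Units.map (ringOfInt p K).val.toMonoidHom v = u := by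
    ext
    simp [hv, hu, add_comm]
  rw [← hvu]
  exact h _ ⟨(v : ringOfInt p K).2, ((v⁻¹ : (ringOfInt p K)ˣ) : ringOfInt p K).2⟩

theorem IsTrivOnK.of_pow {χ : Kˣ →* ℂˣ} {m n N : ℕ} (hpm : ¬ p ∣ m) (hn : 1 ≤ n) (hN : 1 ≤ N)
    (hχ : IsTrivOnK p K χ N) (h : IsTrivOnK p K (χ ^ m) n) : IsTrivOnK p K χ n := by
  have hp : p.Prime := Fact.out
  rw [isTrivOnK_iff_of_pos hn] at h ⊢
  rw [isTrivOnK_iff_of_pos hN] at hχ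
  rintro u ⟨y, hy, hu⟩
  have hm : χ u ^ m = 1 := h u ⟨y, hy, hu⟩
  have hpN : χ u ^ p ^ N = 1 := by
    rw [← map_pow]
    refine hχ _ ⟨(1 + y) ^ p ^ N - 1, Ideal.pow_le_pow_right (Nat.le_add_left N n)
      (one_add_pow_prime_pow_sub_one_mem hp (natCast_prime_mem_maxIdeal p K) hn hy N), ?_⟩
    simp [hu]
  have hcop : Nat.Coprime m (p ^ N) := ((hp.coprime_iff_not_dvd.2 hpm).symm).pow_right N
  rw [← orderOf_eq_one_iff, ← Nat.dvd_one, ← hcop.gcd_eq_one]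
  exact Nat.dvd_gcd (orderOf_dvd_of_pow_eq_one hm) (orderOf_dvd_of_pow_eq_one hpN)

end

/-- Let `p` be a prime, `K` a finite extension of `ℚ_p`, `m` a positive integer not
divisible by `p`, and `χ` a character of `K^×` with conductor `a(χ) ≥ 2`.  Then
`a(χ^m) = a(χ)`. -/
theorem conductor_pow_coprime (p : ℕ) [Fact p.Prime]
    (K : Type*) [Field K] [Algebra ℚ_[p] K] [FiniteDimensional ℚ_[p] K]
    (m : ℕ) (hm : 0 < m) (hpm : ¬ p ∣ m)
    (χ : Kˣ →* ℂˣ) (hfin : ∃ n, IsTrivOnK p K χ n) (h2 : 2 ≤ condK p K χ) :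
    condK p K (χ ^ m) = condK p K χ := by
  have hχ : IsTrivOnK p K χ (condK p K χ) := Nat.sInf_mem hfin
  refine le_antisymm (Nat.sInf_le (hχ.pow m)) ?_
  have hpow : IsTrivOnK p K (χ ^ m) (condK p K (χ ^ m)) :=
    Nat.sInf_mem (s := {n | IsTrivOnK p K (χ ^ m) n}) ⟨_, hχ.pow m⟩
  rcases Nat.eq_zero_or_pos (condK p K (χ ^ m)) with h0 | hpos
  · rw [h0] at hpow
    have h1 : condK p K χ ≤ 1 :=
      Nat.sInf_le (hχ.of_pow hpm le_rfl (by lia) hpow.one_of_zero)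
    lia
  · exact Nat.sInf_le (hχ.of_pow hpm hpos (by lia) hpow)
end
end
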